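/- Let m ≥ 2 and let p_1 < p_2 < ⋯ < p_m be distinct primes, and set n = p_1·p_2⋯p_m. Define a(m) = Σ_{k=0}^{⌊(m+1)/2⌋} C(m−1, k)·C(m−k+1, k). If p_1 > 3^{m−1} − a(m) + 1, then the n×n square has no perfect Mondrian partition into k ≥ p_1 rectangles. -/

import Mathlib

/-- An axis-aligned rectangle with integer coordinates placed on the grid:
lower-left corner `(x, y)`, width `w`, and height `h`. -/
structure Rect where
  x : ℕ
  y : ℕ
  w : ℕ
  h : ℕ
deriving DecidableEq

/-- The area of a rectangle. -/
def Rect.area (r : Rect) : ℕ := r.w * r.h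

/-- Two rectangles are congruent if they have the same dimensions,
possibly after a ninety-degree rotation. -/
def Rect.Congruent (r s : Rect) : Prop :=
  (r.w = s.w ∧ r.h = s.h) ∨ (r.w = s.h ∧ r.h = s.w)

/-- The rectangle `r` covers the unit grid cell `[i, i+1) × [j, j+1)`. -/
def Rect.Covers (r : Rect) (i j : ℕ) : Prop :=
  r.x ≤ i ∧ i < r.x + r.w ∧ r.y ≤ j ∧ j < r.y + r.h

/-- A Mondrian partition of the `n × n` square: a finite collection of
pairwise non-congruent rectangles with positive integer side lengths that
tile the square (every cell of the square is covered by exactly one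
rectangle, and rectangles lie inside the square). -/
structure Mondrian (n : ℕ) where
  rects : Finset Rect
  pos : ∀ r ∈ rects, 0 < r.w ∧ 0 < r.h
  inside : ∀ r ∈ rects, r.x + r.w ≤ n ∧ r.y + r.h ≤ n
  cover : ∀ i j : ℕ, i < n → j < n → ∃! r : Rect, r ∈ rects ∧ r.Covers i j
  noncong : ∀ r ∈ rects, ∀ s ∈ rects, r ≠ s → ¬ r.Congruent s

/-- The defect of a Mondrian partition: the difference between the largest
and the smallest rectangle areas. -/
def Mondrian.defect {n : ℕ} (P : Mondrian n) : ℕ :=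
  P.rects.sup fun r => P.rects.sup fun s => r.area - s.area

/-- A Mondrian partition is perfect if all its rectangles have the same area. -/
def Mondrian.IsPerfect {n : ℕ} (P : Mondrian n) : Prop :=
  ∀ r ∈ P.rects, ∀ s ∈ P.rects, r.area = s.area

/-- `mondrianDk n k` is the minimum defect over all Mondrian partitions of the
`n × n` square using exactly `k` rectangles. -/
noncomputable def mondrianDk (n k : ℕ) : ℕ :=
  sInf {d | ∃ P : Mondrian n, P.rects.card = k ∧ P.defect = d}

/-- `mondrianD n` is the minimum defect over all Mondrian partitions of the
`n × n` square (into at least two rectangles). -/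
noncomputable def mondrianD (n : ℕ) : ℕ :=
  sInf {d | ∃ P : Mondrian n, 2 ≤ P.rects.card ∧ P.defect = d}

/-- `a(m) = Σ_{k=0}^{⌊(m+1)/2⌋} C(m−1, k)·C(m−k+1, k)` (OEIS A025566). -/
def aSeq (m : ℕ) : ℕ :=
  ∑ k ∈ Finset.range ((m + 1) / 2 + 1), Nat.choose (m - 1) k * Nat.choose (m - k + 1) k

/-- The number of words of length `L` over `{-1, 0, 1}` whose sum is at most `j`. -/
def cumTrinomial : ℕ → ℤ → ℤ
  | 0, j => if 0 ≤ j then 1 else 0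
  | L + 1, j => cumTrinomial L (j - 1) + cumTrinomial L j + cumTrinomial L (j + 1)

theorem cumTrinomial_zero (j : ℤ) : cumTrinomial 0 j = if 0 ≤ j then 1 else 0 := rfl

theorem cumTrinomial_succ (L : ℕ) (j : ℤ) :
    cumTrinomial (L + 1) j =
      cumTrinomial L (j - 1) + cumTrinomial L j + cumTrinomial L (j + 1) := rfl

theorem cumTrinomial_eq_zero (L : ℕ) : ∀ j : ℤ, j < -L → cumTrinomial L j = 0 := by
  induction L with
  | zero => intro j hj; rw [cumTrinomial_zero, if_neg (by simpa using hj)]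
  | succ L ih =>
    intro j hj
    push_cast at hj
    rw [cumTrinomial_succ, ih _ (by linarith), ih _ (by linarith), ih _ (by linarith)]
    rfl

theorem cumTrinomial_symm (L : ℕ) :
    ∀ i j : ℤ, i + j = -1 → cumTrinomial L i + cumTrinomial L j = 3 ^ L := by
  induction L with
  | zero =>
    intro i j h
    simp only [cumTrinomial_zero, pow_zero]
    split_ifs <;> omega
  | succ L ih =>
    intro i j h
    have h1 := ih (i - 1) (j + 1) (by linarith)
    have h2 := ih i j h
    have h3 := ih (i + 1) (j - 1) (by linarith)
    rw [cumTrinomial_succ, cumTrinomial_succ, pow_succ]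
    linarith

theorem cumTrinomial_concave (L : ℕ) : ∀ j : ℤ, 0 ≤ j →
    cumTrinomial L (j - 1) + cumTrinomial L (j + 1) ≤ 2 * cumTrinomial L j := by
  induction L with
  | zero =>
    intro j hj
    simp only [cumTrinomial_zero]
    split_ifs <;> omega
  | succ L ih =>
    intro j hj
    simp only [cumTrinomial_succ, sub_add_cancel, add_sub_cancel_right]
    have h0 := ih j hj
    have h1 := ih (j + 1) (by linarith)
    simp only [add_sub_cancel_right] at h1
    rcases hj.eq_or_lt with rfl | hj
    · have s1 := cumTrinomial_symm L (0 - 1 - 1) (0 + 1) (by norm_num)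
      have s2 := cumTrinomial_symm L (0 - 1) 0 (by norm_num)
      linarith
    · have h2 := ih (j - 1) (by omega)
      simp only [sub_add_cancel] at h2
      linarith

/-- The number of walks of length `L` with steps in `{-1, 0, 1}` from `0` to `h` that stay
nonnegative. -/
def ballotCount (L : ℕ) (h : ℤ) : ℤ :=
  cumTrinomial L h - cumTrinomial L (h - 1) - cumTrinomial L (h + 2) + cumTrinomial L (h + 1)

theorem ballotCount_succ (L : ℕ) (h : ℤ) :
    ballotCount (L + 1) h = ballotCount L (h - 1) + ballotCount L h + ballotCount L (h + 1) := by
  simp only [ballotCount, cumTrinomial_succ]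
  ring_nf

theorem ballotCount_neg_one (L : ℕ) : ballotCount L (-1) = 0 := by
  have h1 := cumTrinomial_symm L (-1) 0 (by norm_num)
  have h2 := cumTrinomial_symm L (-2) 1 (by norm_num)
  norm_num [ballotCount]
  linarith

theorem ballotCount_nonneg (L : ℕ) (h : ℤ) (hh : 0 ≤ h) : 0 ≤ ballotCount L h := by
  have h0 := cumTrinomial_concave L h hh
  have h1 := cumTrinomial_concave L (h + 1) (by linarith)
  rw [add_sub_cancel_right, add_assoc] at h1
  norm_num at h1
  unfold ballotCount
  linarith

theorem ballotCount_zero_pos (L : ℕ) : 1 ≤ ballotCount L 0 := by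
  induction L with
  | zero => decide
  | succ L ih =>
    have := ballotCount_nonneg L 1 (by norm_num)
    rw [ballotCount_succ]
    norm_num [ballotCount_neg_one]
    linarith

theorem ballotCount_ratio (L : ℕ) : ∀ h : ℤ, -1 ≤ h →
    (h + 1) * ballotCount L (h + 1) ≤ (h + 2) * ballotCount L h := by
  induction L with
  | zero =>
    intro h hh
    have h1 : ballotCount 0 (h + 1) = if h = -1 then 1 else 0 := by
      simp only [ballotCount, cumTrinomial_zero]
      split_ifs <;> omega
    rw [h1]
    split_ifs with h2
    · subst h2; simp [ballotCount_neg_one]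
    · have := ballotCount_nonneg 0 h (by omega)
      nlinarith
  | succ L ih =>
    intro h hh
    rcases hh.eq_or_lt with rfl | hh
    · simp [ballotCount_neg_one]
    have e1 := ih (h - 1) (by omega)
    have e2 := ih h (by omega)
    have e3 := ih (h + 1) (by omega)
    rw [ballotCount_succ, ballotCount_succ]
    simp only [sub_add_cancel, add_sub_cancel_right] at *
    obtain ⟨H, rfl⟩ : ∃ H, h = H - 1 := ⟨h + 1, by ring⟩
    have hH : 1 ≤ H := by omega
    ring_nf at *
    generalize ballotCount L (-2 + H) = a at *
    generalize ballotCount L (-1 + H) = b at *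
    generalize ballotCount L H = c at *
    generalize ballotCount L (1 + H) = d at *
    have k1 := mul_le_mul_of_nonneg_left e1 (show 0 ≤ (H + 1) ^ 2 by positivity)
    have k2 := mul_le_mul_of_nonneg_left e2 (show 0 ≤ H ^ 2 + H - 1 by nlinarith)
    have k3 := mul_le_mul_of_nonneg_left e3 (show 0 ≤ H ^ 2 by positivity)
    have hpos : 0 < H * (H + 1) := by positivity
    refine le_of_mul_le_mul_left ?_ hpos
    linarith

theorem cumTrinomial_zero_add_one_le (L : ℕ) (hL : 1 ≤ L) :
    2 * (cumTrinomial L 0 + cumTrinomial L 1) ≤ 3 ^ (L + 1) + 1 := by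
  induction L, hL using Nat.le_induction with
  | base => decide
  | succ L _ ih =>
    have h0 := ballotCount_zero_pos L
    have s := cumTrinomial_symm L (-1) 0 (by norm_num)
    simp only [ballotCount, cumTrinomial_succ] at *
    norm_num [pow_succ] at *
    linarith

theorem ballotCount_one_pos (L : ℕ) (hL : 1 ≤ L) : 1 ≤ ballotCount L 1 := by
  obtain ⟨L, rfl⟩ := Nat.exists_eq_add_of_le' hL
  have h0 := ballotCount_zero_pos L
  have h1 := ballotCount_nonneg L 1 (by norm_num)
  have h2 := ballotCount_nonneg L 2 (by norm_num)
  rw [ballotCount_succ]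
  norm_num
  linarith

theorem cumTrinomial_one_two_three_le (L : ℕ) (hL : 6 ≤ L) :
    4 * cumTrinomial L 1 + 2 * cumTrinomial L 2 - 2 * cumTrinomial L 3 ≤ 3 ^ (L + 1) + 1 := by
  induction L, hL using Nat.le_induction with
  | base => decide +kernel
  | succ L hL ih =>
    have h0 := ballotCount_one_pos L (by omega)
    have h1 := ballotCount_ratio L 1 (by norm_num)
    norm_num at h1
    have h2 : ballotCount L 2 + 1 ≤ 2 * ballotCount L 1 := by omega
    clear h1
    have s := cumTrinomial_symm L (-1) 0 (by norm_num)
    simp only [ballotCount, cumTrinomial_succ] at *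
    norm_num [pow_succ] at *
    linarith

theorem cumTrinomial_one_add_two_le (L : ℕ) (hL : 3 ≤ L) :
    27 * (cumTrinomial L 1 + cumTrinomial L 2) ≤ 49 * 3 ^ L := by
  induction L, hL using Nat.le_induction with
  | base => decide +kernel
  | succ L hL ih =>
    have h1 := cumTrinomial_concave L 1 (by norm_num)
    have h2 := cumTrinomial_concave L 2 (by norm_num)
    simp only [cumTrinomial_succ] at *
    norm_num [pow_succ] at *
    linarith

open Polynomial in
theorem coeff_one_add_X_add_X_sq_pow (L : ℕ) : ∀ n : ℕ,
    ((1 + X * (1 + X) : ℤ[X]) ^ L).coeff n =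
      cumTrinomial L (n - L) - cumTrinomial L (n - L - 1) := by
  induction L with
  | zero =>
    intro n
    simp only [pow_zero, coeff_one, cumTrinomial_zero]
    split_ifs <;> omega
  | succ L ih =>
    intro n
    have hexp : ((1 + X * (1 + X) : ℤ[X]) ^ (L + 1)) = (1 + X * (1 + X)) ^ L
        + X ^ 1 * (1 + X * (1 + X)) ^ L + X ^ 2 * (1 + X * (1 + X)) ^ L := by ring
    rw [hexp]
    simp only [coeff_add, coeff_X_pow_mul', cumTrinomial_succ, ih]
    have hz := cumTrinomial_eq_zero L
    rcases n with _ | _ | n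
    · norm_num
      rw [hz (-1 + -(L : ℤ) - 1) (by linarith), hz (-1 + -(L : ℤ) - 1 - 1) (by linarith),
        hz (-1 + -(L : ℤ)) (by linarith), hz (-(L : ℤ) - 1) (by linarith)]
      ring_nf
    · norm_num
      rw [hz (-(L : ℤ) - 1 - 1) (by linarith), hz (-(L : ℤ) - 1) (by linarith)]
      ring_nf
    · norm_num
      ring_nf

open Polynomial in
theorem aSeq_eq (L : ℕ) (hL : 1 ≤ L) :
    (aSeq (L + 1) : ℤ) = cumTrinomial L 1 + cumTrinomial L 2 - 3 ^ L := by
  have hsum : ((aSeq (L + 1) : ℕ) : ℤ) = ((1 + X : ℤ[X]) ^ 2 * (1 + X * (1 + X)) ^ L).coeff L := by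
    have hext : aSeq (L + 1) = ∑ k ∈ Finset.range (L + 1), L.choose k * (L + 2 - k).choose k := by
      unfold aSeq
      rw [Finset.sum_congr rfl fun k hk => ?_]
      · refine Finset.sum_subset (fun k hk => ?_) fun k _ hk => ?_
        · rw [Finset.mem_range] at *
          omega
        · rw [Finset.mem_range] at hk
          rw [Nat.choose_eq_zero_of_lt (by omega : L + 2 - k < k), mul_zero]
      · rw [Finset.mem_range] at hk
        congr 2
        omega
    rw [hext, add_pow (1 : ℤ[X]) (X * (1 + X)), Finset.mul_sum, finsetSum_coeff, Nat.cast_sum]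
    refine Finset.sum_congr rfl fun k hk => ?_
    rw [Finset.mem_range] at hk
    have : ((1 + X : ℤ[X]) ^ 2 * (1 ^ k * (X * (1 + X)) ^ (L - k) * (L.choose k : ℤ[X])))
        = (L.choose k : ℤ[X]) * (X ^ (L - k) * (1 + X) ^ (L + 2 - k)) := by
      rw [show L + 2 - k = 2 + (L - k) by omega, one_pow, mul_pow]
      ring
    rw [this, coeff_natCast_mul, coeff_X_pow_mul', if_pos (by omega), coeff_one_add_X_pow,
      show L - (L - k) = k by omega]
    simp
  have hexp : (1 + X : ℤ[X]) ^ 2 * (1 + X * (1 + X)) ^ L =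
      (1 + X * (1 + X)) ^ (L + 1) + X ^ 1 * (1 + X * (1 + X)) ^ L := by ring
  have h1 := cumTrinomial_symm L 0 (-1) (by norm_num)
  have h2 := cumTrinomial_symm L 1 (-2) (by norm_num)
  have h3 := cumTrinomial_symm L 2 (-3) (by norm_num)
  rw [hsum, hexp, coeff_add, coeff_X_pow_mul', if_pos hL, coeff_one_add_X_add_X_sq_pow,
    coeff_one_add_X_add_X_sq_pow, cumTrinomial_succ, cumTrinomial_succ]
  push_cast [hL]
  ring_nf
  linarith

theorem not_dvd_prod_of_notMem {q : ℕ} (hq : q.Prime) {S : Finset ℕ} (hS : ∀ r ∈ S, r.Prime)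
    (hqS : q ∉ S) : ¬ q ∣ ∏ r ∈ S, r := by
  intro hdvd
  obtain ⟨r, hr, hqr⟩ := (hq.prime.dvd_finsetProd_iff _).1 hdvd
  exact hqS ((Nat.prime_dvd_prime_iff_eq hq (hS r hr)).1 hqr ▸ hr)

theorem cumTrinomial_window_le_card_divisors (x y : ℚ) (e : ℕ) (hy : 1 ≤ y) (hxy : x < y ^ e)
    (S : Finset ℕ) : (∀ q ∈ S, q.Prime) → (∀ q ∈ S, y ≤ q) →
    ∀ (t Y : ℚ) (h : ℕ), 0 < t → y ≤ Y → (∀ q ∈ S, (q : ℚ) ≤ Y) → t * Y ^ h ≤ x →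
      cumTrinomial S.card (e + h + 1) - cumTrinomial S.card (e - h - 1) ≤
        (((∏ q ∈ S, q) ^ 2).divisors.filter fun v : ℕ => t * ((∏ q ∈ S, q : ℕ) : ℚ) < v).card := by
  induction S using Finset.induction_on_max with
  | empty =>
    intro _ _ t Y h _ hyY _ ht
    by_cases heh : h + 1 ≤ e
    · rw [Finset.card_empty, cumTrinomial_zero, cumTrinomial_zero, if_pos (by omega),
        if_pos (by omega), sub_self]
      exact Nat.cast_nonneg _
    · have hlt : t < 1 := by
        by_contra! h1
        have h2 : y ^ e ≤ Y ^ h :=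
          (pow_le_pow_left₀ (by linarith) hyY e).trans
            (pow_le_pow_right₀ (hy.trans hyY) (by omega))
        nlinarith [pow_nonneg (show (0 : ℚ) ≤ Y by linarith) h]
      rw [Finset.card_empty, cumTrinomial_zero, cumTrinomial_zero, if_pos (by omega),
        if_neg (by omega)]
      simp [Finset.filter_singleton, hlt]
  | insert q S hmax ih =>
    intro hp hyS t Y h htpos hyY hY ht
    have hq : q.Prime := hp q (Finset.mem_insert_self q S)
    have hq0 : (0 : ℚ) < q := by exact_mod_cast hq.pos
    have hyq : y ≤ q := hyS q (Finset.mem_insert_self q S)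
    have hqY : (q : ℚ) ≤ Y := hY q (Finset.mem_insert_self q S)
    have hqS : q ∉ S := fun hmem => (hmax q hmem).false
    have hSq : ∀ r ∈ S, (r : ℚ) ≤ q := fun r hr => by exact_mod_cast (hmax r hr).le
    replace ih := ih (fun r hr => hp r (Finset.mem_insert_of_mem hr))
      (fun r hr => hyS r (Finset.mem_insert_of_mem hr))
    rw [Finset.card_insert_of_notMem hqS, Finset.prod_insert hqS]
    have hcop : ¬ q ∣ (∏ r ∈ S, r) ^ 2 := fun hdvd =>
      not_dvd_prod_of_notMem hq (fun r hr => hp r (Finset.mem_insert_of_mem hr)) hqS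
        (hq.dvd_of_dvd_pow hdvd)
    have hM : (∏ r ∈ S, r) ^ 2 ≠ 0 := fun h0 => hcop (h0 ▸ dvd_zero q)
    generalize ∏ r ∈ S, r = M at *
    set D : ℚ → Finset ℕ := fun s => (M ^ 2).divisors.filter fun v : ℕ => s * (M : ℚ) < v with hD
    have hDmem : ∀ s v, v ∈ D s → v ∣ M ^ 2 ∧ s * (M : ℚ) < v := fun s v hv => by
      rw [hD, Finset.mem_filter, Nat.mem_divisors] at hv
      exact ⟨hv.1.1, hv.2⟩
    have hsplit : (D (t * q)).card + (D t).card + (D (t / q)).card ≤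
        (((q * M) ^ 2).divisors.filter fun v : ℕ => t * ((q * M : ℕ) : ℚ) < v).card := by
      have hinj : Function.Injective fun v => q * v := fun a b hab =>
        Nat.eq_of_mul_eq_mul_left hq.pos hab
      have hinj2 : Function.Injective fun v => q ^ 2 * v := fun a b hab =>
        Nat.eq_of_mul_eq_mul_left (pow_pos hq.pos 2) hab
      rw [← Finset.card_image_of_injective (D t) hinj,
        ← Finset.card_image_of_injective (D (t / q)) hinj2, ← Finset.card_union_of_disjoint,
        ← Finset.card_union_of_disjoint]
      · refine Finset.card_le_card fun v hv => ?_
        have hne : (q * M) ^ 2 ≠ 0 := by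
          rw [mul_pow]; exact mul_ne_zero (pow_ne_zero 2 hq.ne_zero) hM
        simp only [Finset.mem_union, Finset.mem_image] at hv
        rw [Finset.mem_filter, Nat.mem_divisors]
        push_cast
        rcases hv with (hv | ⟨u, hu, rfl⟩) | ⟨u, hu, rfl⟩
        · obtain ⟨h1, h2⟩ := hDmem _ _ hv
          refine ⟨⟨h1.trans (mul_pow q M 2 ▸ dvd_mul_left _ _), hne⟩, ?_⟩
          linarith
        · obtain ⟨h1, h2⟩ := hDmem _ _ hu
          refine ⟨⟨?_, hne⟩, ?_⟩
          · rw [mul_pow]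
            exact mul_dvd_mul (dvd_pow_self q two_ne_zero) h1
          · push_cast
            nlinarith
        · obtain ⟨h1, h2⟩ := hDmem _ _ hu
          refine ⟨⟨?_, hne⟩, ?_⟩
          · rw [mul_pow]
            exact mul_dvd_mul_left _ h1
          · push_cast
            rw [div_mul_eq_mul_div, div_lt_iff₀ hq0] at h2
            nlinarith
      · rw [Finset.disjoint_left]
        intro v hv hv'
        obtain ⟨u, hu, rfl⟩ := Finset.mem_image.1 hv'
        rcases Finset.mem_union.1 hv with hv | hv
        · exact hcop (((dvd_pow_self q two_ne_zero).mul_right u).trans (hDmem _ _ hv).1)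
        · obtain ⟨w, hw, hwu⟩ := Finset.mem_image.1 hv
          have hwu' : w = q * u :=
            Nat.eq_of_mul_eq_mul_left hq.pos (by simpa [pow_two, mul_assoc] using hwu)
          exact hcop ((Dvd.intro u hwu'.symm).trans (hDmem _ _ hw).1)
      · rw [Finset.disjoint_left]
        intro v hv hv'
        obtain ⟨u, hu, rfl⟩ := Finset.mem_image.1 hv'
        exact hcop ((Dvd.intro u rfl).trans (hDmem _ _ hv).1)
    have hsplit' : ((D (t * q)).card : ℤ) + (D t).card + (D (t / q)).card ≤
        (((q * M) ^ 2).divisors.filter fun v : ℕ => t * ((q * M : ℕ) : ℚ) < v).card := by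
      exact_mod_cast hsplit
    refine le_trans ?_ hsplit'
    have hpow : t * (q : ℚ) ^ h ≤ x :=
      (mul_le_mul_of_nonneg_left (pow_le_pow_left₀ hq0.le hqY h) htpos.le).trans ht
    have hstay := ih t q h htpos hyq hSq hpow
    have hup := ih (t / q) q (h + 1) (div_pos htpos hq0) hyq hSq (by
      rw [pow_succ]
      field_simp
      linarith)
    have hdown : cumTrinomial S.card (e + h) - cumTrinomial S.card (e - h) ≤
        (D (t * q)).card := by
      rcases h with _ | h
      · simp
      · have := ih (t * q) q h (mul_pos htpos hq0) hyq hSq (by rw [pow_succ] at hpow; linarith)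
        push_cast
        convert this using 3 <;> ring
    simp only [cumTrinomial_succ]
    push_cast at hup
    ring_nf at hup hdown hstay ⊢
    linarith

theorem card_divisors_sq_prod_primes (S : Finset ℕ) (hS : ∀ q ∈ S, q.Prime) :
    ((∏ q ∈ S, q) ^ 2).divisors.card = 3 ^ S.card := by
  induction S using Finset.induction_on with
  | empty => simp
  | insert q S hqS ih =>
    have hq := hS q (Finset.mem_insert_self q S)
    have hS' : ∀ r ∈ S, r.Prime := fun r hr => hS r (Finset.mem_insert_of_mem hr)
    have hcop : Nat.Coprime (q ^ 2) ((∏ r ∈ S, r) ^ 2) :=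
      Nat.Coprime.pow 2 2 ((Nat.Prime.coprime_iff_not_dvd hq).2 (not_dvd_prod_of_notMem hq hS' hqS))
    rw [Finset.prod_insert hqS, mul_pow, hcop.card_divisors_mul, ih hS',
      Finset.card_insert_of_notMem hqS, Nat.divisors_prime_pow hq, Finset.card_map,
      Finset.card_range, pow_succ, mul_comm]

theorem two_mul_card_divisors_sq_ge (N : ℕ) (hN : 0 < N) :
    2 * ((N ^ 2).divisors.filter fun v => N ≤ v).card = (N ^ 2).divisors.card + 1 := by
  have hN2 : N ^ 2 ≠ 0 := by positivity
  have hcard : ((N ^ 2).divisors.filter fun v => N ≤ v).card =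
      ((N ^ 2).divisors.filter fun v => v ≤ N).card := by
    refine Finset.card_bij' (fun v _ => N ^ 2 / v) (fun v _ => N ^ 2 / v) ?_ ?_ ?_ ?_
    · intro v hv
      simp only [Finset.mem_filter, Nat.mem_divisors] at hv ⊢
      refine ⟨⟨Nat.div_dvd_of_dvd hv.1.1, hN2⟩, Nat.div_le_of_le_mul ?_⟩
      nlinarith
    · intro v hv
      simp only [Finset.mem_filter, Nat.mem_divisors] at hv ⊢
      refine ⟨⟨Nat.div_dvd_of_dvd hv.1.1, hN2⟩, ?_⟩
      rw [Nat.le_div_iff_mul_le (Nat.pos_of_dvd_of_pos hv.1.1 (by positivity))]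
      nlinarith
    · intro v hv
      exact Nat.div_div_self (Nat.dvd_of_mem_divisors (Finset.mem_filter.1 hv).1) hN2
    · intro v hv
      exact Nat.div_div_self (Nat.dvd_of_mem_divisors (Finset.mem_filter.1 hv).1) hN2
  have hunion : ((N ^ 2).divisors.filter fun v => N ≤ v) ∪
      ((N ^ 2).divisors.filter fun v => v ≤ N) = (N ^ 2).divisors := by
    rw [← Finset.filter_or, Finset.filter_true_of_mem fun v _ => le_total N v]
  have hinter : ((N ^ 2).divisors.filter fun v => N ≤ v) ∩
      ((N ^ 2).divisors.filter fun v => v ≤ N) = {N} := by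
    ext v
    simp only [Finset.mem_inter, Finset.mem_filter, Nat.mem_divisors, Finset.mem_singleton]
    constructor
    · rintro ⟨⟨_, h1⟩, _, h2⟩
      exact le_antisymm h2 h1
    · rintro rfl
      simp [hN.ne', dvd_pow_self v two_ne_zero]
  have h := Finset.card_union_add_card_inter ((N ^ 2).divisors.filter fun v => N ≤ v)
    ((N ^ 2).divisors.filter fun v => v ≤ N)
  rw [hunion, hinter, Finset.card_singleton] at h
  omega

theorem Mondrian.sum_area {n : ℕ} (P : Mondrian n) : ∑ r ∈ P.rects, r.area = n ^ 2 := by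
  have hU : Finset.range n ×ˢ Finset.range n =
      P.rects.biUnion fun r => Finset.Ico r.x (r.x + r.w) ×ˢ Finset.Ico r.y (r.y + r.h) := by
    ext ⟨i, j⟩
    simp only [Finset.mem_product, Finset.mem_range, Finset.mem_biUnion, Finset.mem_Ico]
    constructor
    · rintro ⟨hi, hj⟩
      obtain ⟨r, ⟨hr, h1, h2, h3, h4⟩, _⟩ := P.cover i j hi hj
      exact ⟨r, hr, ⟨h1, h2⟩, h3, h4⟩
    · rintro ⟨r, hr, ⟨_, h2⟩, _, h4⟩
      have := P.inside r hr
      omega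
  have hcard := congrArg Finset.card hU
  rw [Finset.card_biUnion] at hcard
  · simp only [Finset.card_product, Finset.card_range, Nat.card_Ico, add_tsub_cancel_left] at hcard
    rw [pow_two, hcard]
    rfl
  · intro r hr s hs hrs
    refine Finset.disjoint_left.2 ?_
    rintro ⟨i, j⟩ h1 h2
    simp only [Finset.mem_product, Finset.mem_Ico] at h1 h2
    have := P.inside r hr
    obtain ⟨u, _, hu⟩ := P.cover i j (by omega) (by omega)
    exact hrs ((hu r ⟨hr, h1.1.1, h1.1.2, h1.2⟩).trans (hu s ⟨hs, h2.1.1, h2.1.2, h2.2⟩).symm)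

/-- A side of `r`, chosen not divisible by `q` whenever `q ^ 2` does not divide the area. -/
def Rect.freeSide (q : ℕ) (r : Rect) : ℕ := if q ∣ r.w then r.h else r.w

/-- The side of `r` other than `r.freeSide q`. -/
def Rect.coSide (q : ℕ) (r : Rect) : ℕ := if q ∣ r.w then r.w else r.h

theorem Rect.freeSide_mul_coSide (q : ℕ) (r : Rect) : r.freeSide q * r.coSide q = r.area := by
  unfold freeSide coSide area
  split_ifs
  · exact mul_comm _ _
  · rfl

theorem Rect.congruent_of_sides {q : ℕ} {r s : Rect}
    (h : (r.freeSide q = s.freeSide q ∧ r.coSide q = s.coSide q) ∨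
      (r.freeSide q = s.coSide q ∧ r.coSide q = s.freeSide q)) : r.Congruent s := by
  unfold freeSide coSide at h
  unfold Congruent
  split_ifs at h <;> omega

theorem Rect.not_dvd_freeSide {q : ℕ} {r : Rect} (h : ¬ q * q ∣ r.area) : ¬ q ∣ r.freeSide q := by
  unfold freeSide
  split_ifs with hw
  · exact fun hh => h (mul_dvd_mul hw hh)
  · exact hw

theorem not_mul_self_dvd {q A N j : ℕ} (hq : q.Prime) (hqN : ¬ q ∣ N) (hA : j * A = q * N ^ 2) :
    ¬ q * q ∣ A := fun h =>
  hqN (hq.dvd_of_dvd_pow (Nat.dvd_of_mul_dvd_mul_left hq.pos (hA ▸ h.mul_left j)))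

theorem Mondrian.freeSide_dvd {n : ℕ} {P : Mondrian n} {q A N j : ℕ} (hq : q.Prime)
    (hqN : ¬ q ∣ N) (harea : ∀ r ∈ P.rects, r.area = A) (hA : j * A = q * N ^ 2) {r : Rect}
    (hr : r ∈ P.rects) : r.freeSide q ∣ N ^ 2 := by
  have hfree : ¬ q ∣ r.freeSide q :=
    Rect.not_dvd_freeSide (harea r hr ▸ not_mul_self_dvd hq hqN hA)
  refine Nat.Coprime.dvd_of_dvd_mul_left ((Nat.Prime.coprime_iff_not_dvd hq).2 hfree).symm ?_
  rw [← hA, ← harea r hr, ← r.freeSide_mul_coSide q]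
  exact (dvd_mul_right _ _).mul_left j

theorem Mondrian.freeSide_injOn {n : ℕ} {P : Mondrian n} {q A : ℕ} (hApos : 0 < A)
    (harea : ∀ r ∈ P.rects, r.area = A) : Set.InjOn (Rect.freeSide q) P.rects := by
  intro r hr s hs hrs
  by_contra hne
  refine P.noncong r hr s hs hne (Rect.congruent_of_sides (q := q) (Or.inl ⟨hrs, ?_⟩))
  have h1 := (r.freeSide_mul_coSide q).trans (harea r hr)
  have h2 := (s.freeSide_mul_coSide q).trans (harea s hs)
  rw [hrs] at h1
  refine Nat.eq_of_mul_eq_mul_left (Nat.pos_of_ne_zero fun h0 => ?_) (h1.trans h2.symm)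
  rw [h0, zero_mul] at h1
  omega

/-- If the common area is a proper divisor of `q * N ^ 2`, then not every divisor of `N ^ 2` occurs
as the side of a rectangle that is free of `q`. -/
theorem Mondrian.card_lt_card_divisors {n : ℕ} {P : Mondrian n} {q A N j : ℕ} (hq : q.Prime)
    (hN : 1 < N) (hqN : ¬ q ∣ N) (harea : ∀ r ∈ P.rects, r.area = A) (hA : j * A = q * N ^ 2)
    (hj : j ≠ 1) : P.rects.card < (N ^ 2).divisors.card := by
  have hN2 : N ^ 2 ≠ 0 := by positivity
  have hApos : 0 < A := Nat.pos_of_ne_zero fun h0 => by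
    rw [h0, mul_zero] at hA
    exact mul_ne_zero hq.ne_zero hN2 hA.symm
  rw [← Finset.card_image_of_injOn (freeSide_injOn (q := q) hApos harea)]
  have hsub : P.rects.image (Rect.freeSide q) ⊆ (N ^ 2).divisors := fun v hv => by
    obtain ⟨r, hr, rfl⟩ := Finset.mem_image.1 hv
    exact Nat.mem_divisors.2 ⟨freeSide_dvd hq hqN harea hA hr, hN2⟩
  refine Finset.card_lt_card (hsub.ssubset_of_ne fun heq => ?_)
  have htop : N ^ 2 ∈ P.rects.image (Rect.freeSide q) := heq ▸ Nat.mem_divisors_self _ hN2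
  have hone : 1 ∈ P.rects.image (Rect.freeSide q) := heq ▸ Nat.one_mem_divisors.2 hN2
  obtain ⟨r, hr, hrv⟩ := Finset.mem_image.1 htop
  obtain ⟨s, hs, hsv⟩ := Finset.mem_image.1 hone
  have h1 := (r.freeSide_mul_coSide q).trans (harea r hr)
  have h2 := (s.freeSide_mul_coSide q).trans (harea s hs)
  rw [hrv] at h1
  rw [hsv, one_mul] at h2
  have hjc : j * r.coSide q = q := by
    refine Nat.eq_of_mul_eq_mul_right (Nat.pos_of_ne_zero hN2) ?_
    rw [← hA, ← h1]
    ring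
  have hc : r.coSide q = 1 := by
    rcases (Nat.dvd_prime hq).1 (Dvd.intro _ hjc) with h | h
    · exact absurd h hj
    · rw [h] at hjc
      exact (Nat.mul_eq_left hq.ne_zero).1 hjc
  rw [hc, mul_one] at h1
  have hrs : r = s := by
    by_contra hne
    exact P.noncong r hr s hs hne
      (Rect.congruent_of_sides (q := q) (Or.inr ⟨by rw [hrv, h2, h1], by rw [hc, hsv]⟩))
  rw [hrs, hsv] at hrv
  nlinarith

/-- If the common area is `q * N ^ 2`, the sides that are free of `q` are divisors of `N ^ 2` lying
between `N` and `q * N`. -/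
theorem Mondrian.two_mul_card_add_le {n : ℕ} {P : Mondrian n} {q N : ℕ} (hq : q.Prime)
    (hN : 0 < N) (hqN : ¬ q ∣ N) (hn : n = q * N) (harea : ∀ r ∈ P.rects, r.area = q * N ^ 2) :
    2 * P.rects.card + 2 * ((N ^ 2).divisors.filter fun v => q * N < v).card ≤
      (N ^ 2).divisors.card + 1 := by
  have hN2 : N ^ 2 ≠ 0 := by positivity
  have hApos : 0 < q * N ^ 2 := mul_pos hq.pos (by positivity)
  rw [← two_mul_card_divisors_sq_ge N hN, ← mul_add,
    ← Finset.card_image_of_injOn (freeSide_injOn (q := q) hApos harea),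
    ← Finset.card_union_of_disjoint]
  · refine Nat.mul_le_mul_left 2 (Finset.card_le_card fun v hv => ?_)
    rcases Finset.mem_union.1 hv with hv | hv
    · obtain ⟨r, hr, rfl⟩ := Finset.mem_image.1 hv
      refine Finset.mem_filter.2
        ⟨Nat.mem_divisors.2 ⟨freeSide_dvd hq hqN harea (one_mul _) hr, hN2⟩, ?_⟩
      have hfree : ¬ q ∣ r.freeSide q :=
        Rect.not_dvd_freeSide (harea r hr ▸ not_mul_self_dvd hq hqN (one_mul _))
      have hmul := (r.freeSide_mul_coSide q).trans (harea r hr)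
      have hco : r.coSide q ≤ q * N := by
        have := P.inside r hr
        unfold Rect.coSide
        split_ifs <;> omega
      obtain ⟨u, hu⟩ := ((hq.dvd_mul).1 (hmul ▸ dvd_mul_right q (N ^ 2))).resolve_left hfree
      rw [hu] at hmul hco
      have huN : u ≤ N := Nat.le_of_mul_le_mul_left hco hq.pos
      have hvu : r.freeSide q * u = N ^ 2 := Nat.eq_of_mul_eq_mul_left hq.pos (by
        rw [← hmul]
        ring)
      nlinarith
    · rw [Finset.mem_filter] at hv ⊢
      exact ⟨hv.1, by nlinarith [hq.one_lt]⟩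
  · rw [Finset.disjoint_left]
    intro v hv hv'
    obtain ⟨r, hr, rfl⟩ := Finset.mem_image.1 hv
    have hle : r.freeSide q ≤ q * N := by
      have := P.inside r hr
      unfold Rect.freeSide
      split_ifs <;> omega
    exact absurd (Finset.mem_filter.1 hv').2 (not_lt.2 hle)

theorem cumTrinomial_le_card_divisors_gt (S : Finset ℕ) (hS : ∀ r ∈ S, r.Prime) {q y e : ℕ}
    (hq : 0 < q) (hy : 1 ≤ y) (hqy : q < y ^ e) (hyS : ∀ r ∈ S, y ≤ r) :
    cumTrinomial S.card (e + 1) - cumTrinomial S.card (e - 1) ≤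
      (((∏ r ∈ S, r) ^ 2).divisors.filter fun v => q * ∏ r ∈ S, r < v).card := by
  have h := cumTrinomial_window_le_card_divisors q y e (by exact_mod_cast hy)
    (by exact_mod_cast hqy) S hS (fun r hr => by exact_mod_cast hyS r hr) q
    ((y + ∑ r ∈ S, r : ℕ) : ℚ) 0 (by exact_mod_cast hq) (by exact_mod_cast Nat.le_add_right _ _)
    (fun r hr => by
      exact_mod_cast (Finset.single_le_sum (fun _ _ => Nat.zero_le _) hr).trans
        (Nat.le_add_left (∑ r ∈ S, r) y)) (by simp)
  simp only [Nat.cast_zero, add_zero, sub_zero] at h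
  exact_mod_cast h

/-- A natural number larger than `3 ^ L - a(L + 1) + 1` has square at least `3 ^ L`. -/
theorem three_pow_le_sq {L : ℕ} (hL : 1 ≤ L) {x : ℕ}
    (hx : (3 : ℤ) ^ L - aSeq (L + 1) + 1 < x) : 3 ^ L ≤ x ^ 2 := by
  rcases Nat.lt_or_ge L 3 with hL3 | hL3
  · interval_cases L
    · have : aSeq (1 + 1) = 3 := by decide
      rw [this] at hx
      have : 2 ≤ x := by omega
      nlinarith
    · have : aSeq (2 + 1) = 8 := by decide
      rw [this] at hx
      have : 3 ≤ x := by omega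
      nlinarith
  · have h := cumTrinomial_one_add_two_le L hL3
    rw [aSeq_eq L hL] at hx
    obtain ⟨K, rfl⟩ := Nat.exists_eq_add_of_le' hL3
    zify
    rw [pow_add] at *
    have hw : (1 : ℤ) ≤ 3 ^ K := one_le_pow₀ (by norm_num)
    have hx' : 5 * (3 : ℤ) ^ K + 2 ≤ x := by linarith
    nlinarith

theorem prime_gt_contradiction {L : ℕ} (hL : 1 ≤ L) {x q : ℕ} (hxp : x.Prime) (hq : q.Prime)
    (hxq : x < q) (hx : (3 : ℤ) ^ L - aSeq (L + 1) + 1 < x)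
    (hcount : 2 * (q : ℤ) + 2 * (cumTrinomial L 3 - cumTrinomial L 1) ≤ 3 ^ L + 1) : False := by
  rcases Nat.lt_or_ge L 6 with hL6 | hL6
  · interval_cases L
    · have h1 : cumTrinomial 1 3 - cumTrinomial 1 1 = 0 := by decide +kernel
      have := hxp.two_le
      omega
    · have h1 : cumTrinomial 2 3 - cumTrinomial 2 1 = 1 := by decide +kernel
      have h2 : aSeq (2 + 1) = 8 := by decide
      rw [h1] at hcount
      rw [h2] at hx
      obtain rfl : q = 4 := by omega
      norm_num at hq
    · have h1 : cumTrinomial 3 3 - cumTrinomial 3 1 = 4 := by decide +kernel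
      have h2 : aSeq (3 + 1) = 22 := by decide
      rw [h1] at hcount
      rw [h2] at hx
      have h3 : 8 ≤ q := by omega
      have h4 : q ≤ 10 := by omega
      interval_cases q <;> norm_num at hq
    · have h1 : cumTrinomial 4 3 - cumTrinomial 4 1 = 14 := by decide +kernel
      have h2 : aSeq (4 + 1) = 61 := by decide
      rw [h1] at hcount
      rw [h2] at hx
      have h3 : 22 ≤ x := by omega
      have h4 : q ≤ 27 := by omega
      have h5 : x ≠ 22 := by rintro rfl; norm_num at hxp
      have h6 : 24 ≤ q := by omega
      interval_cases q <;> norm_num at hq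
    · have h1 : cumTrinomial 5 3 - cumTrinomial 5 1 = 45 := by decide +kernel
      have h2 : aSeq (5 + 1) = 171 := by decide
      rw [h1] at hcount
      rw [h2] at hx
      have h3 : 75 ≤ q := by omega
      have h4 : q ≤ 77 := by omega
      interval_cases q <;> norm_num at hq
  · have h := cumTrinomial_one_two_three_le L hL6
    rw [aSeq_eq L hL] at hx
    rw [pow_succ] at h
    have : (x : ℤ) < q := by exact_mod_cast hxq
    linarith

/-- Let `p₁ < ⋯ < p_m` (`m ≥ 2`) be primes and `n = p₁ ⋯ p_m`. If
`p₁ > 3^{m−1} − a(m) + 1`, then the `n × n` square has no perfect Mondrian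
partition into `k ≥ p₁` rectangles. -/
theorem no_perfect_squarefree_of_small_prime (m : ℕ) (hm : 2 ≤ m)
    (p : Fin m → ℕ) (hp : ∀ i, (p i).Prime) (hmono : StrictMono p)
    (hbig : (3 : ℤ) ^ (m - 1) - (aSeq m : ℤ) + 1 < (p ⟨0, by omega⟩ : ℤ)) :
    ∀ P : Mondrian (∏ i, p i), p ⟨0, by omega⟩ ≤ P.rects.card → ¬ P.IsPerfect := by
  obtain ⟨L, rfl⟩ : ∃ L, m = L + 1 := ⟨m - 1, by omega⟩
  have hL : 1 ≤ L := by omega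
  rw [add_tsub_cancel_right] at hbig
  intro P hcard hperf
  set x := p ⟨0, by omega⟩
  have hxp : x.Prime := hp _
  have hxi : ∀ i, x ≤ p i := fun i => hmono.monotone (Fin.zero_le i)
  have hk2 : 2 ≤ P.rects.card := hxp.two_le.trans hcard
  obtain ⟨r₀, hr₀⟩ := Finset.card_pos.1 (by omega : 0 < P.rects.card)
  have harea : ∀ r ∈ P.rects, r.area = r₀.area := fun r hr => hperf r hr r₀ hr₀
  have hkA : P.rects.card * r₀.area = (∏ i, p i) ^ 2 := by
    rw [← P.sum_area, Finset.sum_congr rfl harea, Finset.sum_const, smul_eq_mul]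
  have hfactor : ∀ q : ℕ, q.Prime → q ∣ P.rects.card → ∃ i, q = p i := by
    intro q hq hqk
    obtain ⟨i, _, hi⟩ := (hq.prime.dvd_finsetProd_iff _).1
      (hq.dvd_of_dvd_pow (hkA ▸ hqk.mul_right r₀.area))
    exact ⟨i, (Nat.prime_dvd_prime_iff_eq hq (hp i)).1 hi⟩
  obtain ⟨i, hi⟩ := hfactor _ (Nat.minFac_prime (by omega)) (Nat.minFac_dvd P.rects.card)
  obtain ⟨j, hj⟩ : p i ∣ P.rects.card := hi ▸ Nat.minFac_dvd _
  have hq := hp i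
  set S : Finset ℕ := (Finset.univ.erase i).image p with hSdef
  have hSmem : ∀ r ∈ S, ∃ k, k ≠ i ∧ p k = r := fun r hr => by
    obtain ⟨k, hk, rfl⟩ := Finset.mem_image.1 hr
    exact ⟨k, Finset.ne_of_mem_erase hk, rfl⟩
  have hS : ∀ r ∈ S, r.Prime := fun r hr => by
    obtain ⟨k, _, rfl⟩ := hSmem r hr
    exact hp k
  have hSx : ∀ r ∈ S, x ≤ r := fun r hr => by
    obtain ⟨k, _, rfl⟩ := hSmem r hr
    exact hxi k
  have hScard : S.card = L := by
    rw [hSdef, Finset.card_image_of_injective _ hmono.injective,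
      Finset.card_erase_of_mem (Finset.mem_univ i), Finset.card_univ, Fintype.card_fin,
      add_tsub_cancel_right]
  have hqS : p i ∉ S := fun hmem => by
    obtain ⟨k, hk, hki⟩ := hSmem _ hmem
    exact hk (hmono.injective hki)
  have hn : ∏ i, p i = p i * ∏ r ∈ S, r := by
    rw [hSdef, Finset.prod_image fun _ _ _ _ h => hmono.injective h,
      Finset.mul_prod_erase _ _ (Finset.mem_univ i)]
  have hqN := not_dvd_prod_of_notMem hq hS hqS
  have hdiv := card_divisors_sq_prod_primes S hS
  rw [hScard] at hdiv
  have hN0 : 0 < ∏ r ∈ S, r := Finset.prod_pos fun r hr => (hS r hr).pos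
  have hN1 : 1 < ∏ r ∈ S, r := by
    obtain ⟨r, hr⟩ := Finset.card_pos.1 (by omega : 0 < S.card)
    exact (hS r hr).one_lt.trans_le (Finset.single_le_prod' (fun s hs => (hS s hs).one_lt.le) hr)
  have hjA : j * r₀.area = p i * (∏ r ∈ S, r) ^ 2 := by
    refine Nat.eq_of_mul_eq_mul_left hq.pos ?_
    rw [← mul_assoc, ← hj, hkA, hn]
    ring
  have hsq := three_pow_le_sq hL hbig
  by_cases hj1 : j = 1
  · rw [hj1, one_mul] at hjA
    rw [hj1, mul_one] at hj
    have hcount := Mondrian.two_mul_card_add_le hq hN0 hqN hn (hjA ▸ harea)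
    rw [hdiv, hj] at hcount
    set c := (((∏ r ∈ S, r) ^ 2).divisors.filter fun v => p i * ∏ r ∈ S, r < v).card
    rcases (hxi i).eq_or_lt with heq | hlt
    · have hwin := cumTrinomial_le_card_divisors_gt S hS (q := p i) (y := p i + 1) (e := 1) hq.pos
        (by omega) (by rw [pow_one]; omega) fun r hr => by
          obtain ⟨k, hk, rfl⟩ := hSmem r hr
          exact ((heq ▸ hxi k).lt_of_ne' fun h => hk (hmono.injective h))
      have h := cumTrinomial_zero_add_one_le L hL
      rw [aSeq_eq L hL] at hbig
      rw [hScard] at hwin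
      rw [pow_succ] at h
      norm_num at hwin
      zify at hcount
      rw [heq] at hbig
      linarith
    · have h3 : 3 ≤ 3 ^ L := Nat.le_self_pow (by omega) 3
      have hwin := cumTrinomial_le_card_divisors_gt S hS (q := p i) (y := x) (e := 2) hq.pos
        hxp.one_lt.le (by omega) hSx
      rw [hScard] at hwin
      norm_num at hwin
      zify at hcount
      exact prime_gt_contradiction hL hxp hq hlt hbig (by linarith)
  · have hlt := Mondrian.card_lt_card_divisors hq hN1 hqN harea hjA hj1
    have hxj : x ≤ j := by
      obtain ⟨k, hk⟩ := hfactor _ (Nat.minFac_prime hj1)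
        ((Nat.minFac_dvd j).trans (hj ▸ dvd_mul_left j (p i)))
      have hj0 : 0 < j := Nat.pos_of_ne_zero fun h0 => by
        rw [h0, mul_zero] at hj
        omega
      exact (hxi k).trans (hk ▸ Nat.minFac_le hj0)
    have := Nat.mul_le_mul (hxi i) hxj
    rw [hdiv, hj] at hlt
    nlinarith
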